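/- Let W be an m×m symmetric unitary complex matrix and for each even n define f_n := ∑_{x ∈ {1,…,m}^n} |Haf(W_x)|². Then for every even n ≥ 2, the recurrence f_n = (n−1)·(m+n−2)·f_{n−2} holds, with f_0 = 1. -/

import Mathlib

/-- The Hafnian of a matrix over a linearly ordered finite index type, defined as the sum
over all perfect matchings (fixed-point-free involutions) of the products of entries over
the matched pairs. -/
noncomputable def hafnian {ι : Type*} [Fintype ι] [LinearOrder ι] (V : Matrix ι ι ℂ) : ℂ :=
  ∑ π ∈ Finset.univ.filter (fun π : Equiv.Perm ι => ∀ i, π (π i) = i ∧ π i ≠ i),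
    ∏ i ∈ Finset.univ.filter (fun i => i < π i), V i (π i)

/-- Two transversals of the orbits of a map give the same product of a function invariant under
that map. -/
theorem Finset.prod_transversal_eq {ι M : Type*} [DecidableEq ι] [CommMonoid M] (p : ι → ι)
    (hp : ∀ i, p (p i) = i) (S T : Finset ι) (hS : ∀ i, i ∈ S ↔ p i ∉ S)
    (hT : ∀ i, i ∈ T ↔ p i ∉ T) (g : ι → M) (hg : ∀ i, g (p i) = g i) :
    ∏ i ∈ S, g i = ∏ i ∈ T, g i := by
  refine Finset.prod_bij' (fun i _ => if i ∈ T then i else p i)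
    (fun i _ => if i ∈ S then i else p i) ?_ ?_ ?_ ?_ ?_ <;> intro i hi
  · grind
  · grind
  · grind
  · grind
  · grind

/-- The Hafnian of a symmetric matrix is invariant under reindexing. -/
theorem hafnian_submatrix_equiv {ι κ : Type*} [Fintype ι] [LinearOrder ι] [Fintype κ]
    [LinearOrder κ] (e : ι ≃ κ) (V : Matrix κ κ ℂ) (hV : ∀ i j, V i j = V j i) :
    hafnian (V.submatrix e e) = hafnian V := by
  unfold hafnian
  refine Finset.sum_equiv e.permCongr ?_ ?_
  · intro π
    simp [← e.forall_congr_right]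
  · intro π hπ
    simp only [Finset.mem_filter, Finset.mem_univ, true_and] at hπ
    have h1 : ∏ k ∈ Finset.univ.filter (fun k => k < e.permCongr π k), V k (e.permCongr π k) =
        ∏ i ∈ Finset.univ.filter (fun i => e i < e (π i)), V (e i) (e (π i)) := by
      symm
      refine Finset.prod_equiv e (fun i => ?_) (fun i _ => by simp)
      rw [Finset.mem_filter, Finset.mem_filter]
      simp
    rw [h1]
    refine Finset.prod_transversal_eq π (fun i => (hπ i).1) _ _ ?_ ?_
      (fun i => V (e i) (e (π i))) ?_
    · intro i
      have := hπ i
      simp only [Finset.mem_filter, Finset.mem_univ, true_and, this.1, not_lt]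
      exact ⟨le_of_lt, fun h => lt_of_le_of_ne h (Ne.symm this.2)⟩
    · intro i
      have := hπ i
      simp only [Finset.mem_filter, Finset.mem_univ, true_and, this.1, not_lt]
      exact ⟨le_of_lt, fun h => lt_of_le_of_ne h fun h' => this.2 (e.injective h').symm⟩
    · intro i
      simp only [(hπ i).1]
      exact hV _ _

/-- The permutation of `Fin (n + 2)` that swaps `0` with `j.succ` and acts as `σ` on the other
elements. -/
noncomputable def Equiv.Perm.insertPair {n : ℕ} (j : Fin (n + 1)) (σ : Equiv.Perm (Fin n)) :
    Equiv.Perm (Fin (n + 2)) :=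
  Equiv.swap 0 j.succ *
    σ.extendDomain (Equiv.ofInjective (fun i => (j.succAbove i).succ)
      ((Fin.succ_injective _).comp j.succAbove_right_injective))

theorem Equiv.Perm.insertPair_succ_succAbove {n : ℕ} (j : Fin (n + 1)) (σ : Equiv.Perm (Fin n))
    (i : Fin n) :
    insertPair j σ (j.succAbove i).succ = (j.succAbove (σ i)).succ := by
  have h := σ.extendDomain_apply_image (Equiv.ofInjective (fun i => (j.succAbove i).succ)
      ((Fin.succ_injective _).comp j.succAbove_right_injective)) i
  simp only [Equiv.ofInjective_apply] at h
  rw [insertPair, Equiv.Perm.mul_apply, h]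
  exact Equiv.swap_apply_of_ne_of_ne (Fin.succ_ne_zero _)
    (fun h => j.succAbove_ne _ (Fin.succ_injective _ h))

theorem Equiv.Perm.insertPair_zero {n : ℕ} (j : Fin (n + 1)) (σ : Equiv.Perm (Fin n)) :
    insertPair j σ 0 = j.succ := by
  rw [insertPair, Equiv.Perm.mul_apply, Equiv.Perm.extendDomain_apply_not_subtype,
    Equiv.swap_apply_left]
  rintro ⟨i, hi⟩
  exact Fin.succ_ne_zero _ hi

theorem Equiv.Perm.insertPair_succ {n : ℕ} (j : Fin (n + 1)) (σ : Equiv.Perm (Fin n)) :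
    insertPair j σ j.succ = 0 := by
  rw [insertPair, Equiv.Perm.mul_apply, Equiv.Perm.extendDomain_apply_not_subtype,
    Equiv.swap_apply_right]
  rintro ⟨i, hi⟩
  exact j.succAbove_ne _ (Fin.succ_injective _ hi)

theorem Fin.forall_zero_succ_succAbove {n : ℕ} (j : Fin (n + 1)) {P : Fin (n + 2) → Prop} :
    (∀ i, P i) ↔ P 0 ∧ P j.succ ∧ ∀ i, P (j.succAbove i).succ := by
  rw [Fin.forall_fin_succ, Fin.forall_iff_succAbove j]

/-- Expansion of the Hafnian along the first row. -/
theorem hafnian_succ_succ {n : ℕ} (V : Matrix (Fin (n + 2)) (Fin (n + 2)) ℂ) :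
    hafnian V = ∑ j : Fin (n + 1), V 0 j.succ *
      hafnian (V.submatrix (fun i : Fin n => (j.succAbove i).succ)
        (fun i => (j.succAbove i).succ)) := by
  unfold hafnian
  rw [← Finset.sum_fiberwise (g := fun π : Equiv.Perm (Fin (n + 2)) => π 0), Fin.sum_univ_succ]
  rw [Finset.sum_eq_zero, zero_add]
  swap
  · intro π hπ
    simp only [Finset.mem_filter, Finset.mem_univ, true_and] at hπ
    exact absurd hπ.2 (hπ.1 0).2
  refine Finset.sum_congr rfl fun j _ => ?_
  rw [Finset.mul_sum]
  symm
  refine Finset.sum_bij (fun σ _ => Equiv.Perm.insertPair j σ) ?_ ?_ ?_ ?_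
  · intro σ hσ
    simp only [Finset.mem_filter, Finset.mem_univ, true_and] at hσ ⊢
    refine ⟨?_, Equiv.Perm.insertPair_zero j σ⟩
    rw [Fin.forall_zero_succ_succAbove j]
    simp only [Equiv.Perm.insertPair_zero, Equiv.Perm.insertPair_succ,
      Equiv.Perm.insertPair_succ_succAbove, ne_eq, Fin.succ_inj, true_and,
      (hσ _).1, j.succAbove_right_inj, (hσ _).2]
    simp [Fin.succ_ne_zero, (Fin.succ_ne_zero _).symm]
  · intro σ _ τ _ h
    ext1 i
    have := congrArg (fun ρ : Equiv.Perm _ => ρ (j.succAbove i).succ) h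
    simpa [Equiv.Perm.insertPair_succ_succAbove] using this
  · intro π hπ
    simp only [Finset.mem_filter, Finset.mem_univ, true_and] at hπ
    obtain ⟨hπ, h0⟩ := hπ
    have hj : π j.succ = 0 := by rw [← h0, (hπ 0).1]
    have key : ∀ i : Fin n, ∃ k : Fin n, (j.succAbove k).succ = π (j.succAbove i).succ := by
      intro i
      obtain ⟨l, hl⟩ := Fin.exists_succ_eq.mpr (show π (j.succAbove i).succ ≠ 0 by
        rw [← hj]
        exact fun h => j.succAbove_ne i (Fin.succ_injective _ (π.injective h)))
      obtain ⟨k, hk⟩ := Fin.exists_succAbove_eq (x := l) (y := j) (by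
        rintro rfl
        rw [← h0] at hl
        exact Fin.succ_ne_zero _ (π.injective hl).symm)
      exact ⟨k, by rw [hk, hl]⟩
    choose s hs using key
    have hinv : Function.Involutive s := fun i => by
      have h := hs (s i)
      rw [hs i, (hπ _).1] at h
      exact j.succAbove_right_injective (Fin.succ_injective _ h)
    refine ⟨hinv.toPerm s, ?_, ?_⟩
    · simp only [Finset.mem_filter, Finset.mem_univ, true_and, Function.Involutive.coe_toPerm]
      refine fun i => ⟨hinv i, fun h => (hπ (j.succAbove i).succ).2 ?_⟩
      rw [← hs, h]
    · refine Equiv.ext ?_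
      rw [Fin.forall_zero_succ_succAbove j]
      exact ⟨by rw [Equiv.Perm.insertPair_zero, h0], by rw [Equiv.Perm.insertPair_succ, hj],
        fun i => by rw [Equiv.Perm.insertPair_succ_succAbove, ← hs]; rfl⟩
  · intro σ _
    simp only [Finset.prod_filter]
    rw [Fin.prod_univ_succ, Fin.prod_univ_succAbove _ j]
    simp [Equiv.Perm.insertPair_zero, Equiv.Perm.insertPair_succ,
      Equiv.Perm.insertPair_succ_succAbove]

/-- Deleting either of two equal coordinates of `y` gives the same Hafnian. -/
theorem hafnian_comp_succAbove_eq {α : Type*} {n : ℕ} (W : Matrix α α ℂ)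
    (hW : ∀ i j, W i j = W j i) (y : Fin (n + 1) → α) {j k : Fin (n + 1)} (hjk : y j = y k) :
    hafnian (W.submatrix (y ∘ j.succAbove) (y ∘ j.succAbove)) =
      hafnian (W.submatrix (y ∘ k.succAbove) (y ∘ k.succAbove)) := by
  have key : ∀ i : Fin n, ∃ l, j.succAbove l = Equiv.swap j k (k.succAbove i) := fun i =>
    Fin.exists_succAbove_eq fun h => k.succAbove_ne i (by
      rwa [Equiv.swap_apply_eq_iff, Equiv.swap_apply_left] at h)
  choose s hs using key
  have hinj : Function.Injective s := fun a b h => by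
    have := hs a
    rw [h, hs b] at this
    exact (k.succAbove_right_injective ((Equiv.swap j k).injective this)).symm
  have hy : ∀ i, y (Equiv.swap j k i) = y i := fun i => by
    rw [Equiv.swap_apply_def]; split_ifs <;> simp_all
  rw [← hafnian_submatrix_equiv (Equiv.ofBijective s (Finite.injective_iff_bijective.mp hinj))
    (W.submatrix (y ∘ j.succAbove) (y ∘ j.succAbove)) (fun _ _ => hW _ _)]
  congr 1
  ext a b
  simp [hs, hy]

/-- The columns of a unitary matrix are orthonormal. -/
theorem Matrix.sum_mul_conj_eq_ite {α : Type*} [Fintype α] [DecidableEq α] {W : Matrix α α ℂ}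
    (hW : W * W.conjTranspose = 1) (p q : α) :
    ∑ a, W a p * (starRingEnd ℂ) (W a q) = if p = q then 1 else 0 := by
  have h' : W.conjTranspose * W = 1 := mul_eq_one_comm.mp hW
  have h := congrFun (congrFun h' q) p
  simp only [Matrix.mul_apply, Matrix.conjTranspose_apply, Matrix.one_apply] at h
  simp only [mul_comm (W _ p), eq_comm (a := p)]
  exact h

/-- The squared norm of a linear combination of columns of a unitary matrix, with repetitions
allowed, expanded by orthonormality. -/
theorem Matrix.sum_normSq_combination {α ι : Type*} [Fintype α] [DecidableEq α] [Fintype ι]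
    {W : Matrix α α ℂ} (hW : W * W.conjTranspose = 1) (y : ι → α) (h : ι → ℂ) :
    ∑ a, ((Complex.normSq (∑ j, W a (y j) * h j) : ℝ) : ℂ) =
      ∑ j, ∑ k, if y j = y k then h j * (starRingEnd ℂ) (h k) else 0 := by
  simp only [← Complex.mul_conj, map_sum, map_mul, Finset.sum_mul_sum]
  rw [Finset.sum_comm]
  refine Finset.sum_congr rfl fun j _ => ?_
  rw [Finset.sum_comm]
  refine Finset.sum_congr rfl fun k _ => ?_
  rw [← mul_boole, ← Matrix.sum_mul_conj_eq_ite hW, Finset.mul_sum]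
  exact Finset.sum_congr rfl fun a _ => by ring

/-- The recurrence over an arbitrary finite index type, for all `n`. -/
theorem hafnian_sum_succ_succ {α : Type*} [Fintype α] [DecidableEq α] (W : Matrix α α ℂ)
    (hWsym : ∀ i j, W i j = W j i) (hWunit : W * W.conjTranspose = 1) (n : ℕ) :
    ∑ x : Fin (n + 2) → α, Complex.normSq (hafnian (W.submatrix x x)) =
      (n + 1) * (Fintype.card α + n) *
        ∑ x : Fin n → α, Complex.normSq (hafnian (W.submatrix x x)) := by
  have hrow (y : Fin (n + 1) → α) :
      ∑ a, Complex.normSq (hafnian (W.submatrix (Fin.cons a y : Fin (n + 2) → α)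
        (Fin.cons a y : Fin (n + 2) → α))) =
      ∑ j, ∑ k, if y j = y k then
        Complex.normSq (hafnian (W.submatrix (y ∘ j.succAbove) (y ∘ j.succAbove))) else 0 := by
    apply Complex.ofReal_injective
    push_cast
    have h := Matrix.sum_normSq_combination hWunit y
      (fun j => hafnian (W.submatrix (y ∘ j.succAbove) (y ∘ j.succAbove)))
    refine Eq.trans (Finset.sum_congr rfl fun a _ => ?_) (h.trans ?_)
    · rw [hafnian_succ_succ]
      rfl
    · refine Finset.sum_congr rfl fun j _ => Finset.sum_congr rfl fun k _ => ?_
      split_ifs with hjk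
      · rw [← hafnian_comp_succAbove_eq W hWsym y hjk, Complex.mul_conj]
      · rfl
  rw [← (Fin.consEquiv fun _ : Fin (n + 2) => α).sum_comp, Fintype.sum_prod_type_right]
  refine (Finset.sum_congr rfl fun y _ => hrow y).trans ?_
  rw [Finset.sum_comm]
  have hcol (j : Fin (n + 1)) : ∑ y : Fin (n + 1) → α, ∑ k, (if y j = y k then
        Complex.normSq (hafnian (W.submatrix (y ∘ j.succAbove) (y ∘ j.succAbove))) else 0) =
      (Fintype.card α + n) *
        ∑ x : Fin n → α, Complex.normSq (hafnian (W.submatrix x x)) := by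
    rw [← (Fin.insertNthEquiv (fun _ : Fin (n + 1) => α) j).sum_comp,
      Fintype.sum_prod_type_right, Finset.mul_sum]
    refine Finset.sum_congr rfl fun z _ => ?_
    have hz (a : α) :
        Fin.insertNthEquiv (fun _ : Fin (n + 1) => α) j (a, z) ∘ j.succAbove = z := by
      ext i; simp
    simp only [hz, Fin.insertNthEquiv_apply, Fin.sum_univ_succAbove _ j,
      Fin.insertNth_apply_same, Fin.insertNth_apply_succAbove, Finset.sum_add_distrib]
    rw [Finset.sum_comm]
    simp
    ring
  simp only [hcol, Finset.sum_const, Finset.card_univ, Fintype.card_fin, nsmul_eq_mul]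
  push_cast
  ring

/-- The recurrence `f_n = (n − 1)(m + n − 2) f_{n−2}` for
`f_n := ∑_{x ∈ [m]^n} |Haf(W_x)|²`, for every even `n ≥ 2`, together with `f_0 = 1`,
for a symmetric unitary `m × m` matrix `W`. -/
theorem hafnian_sum_recurrence (m : ℕ) (W : Matrix (Fin m) (Fin m) ℂ)
    (hWsym : W.transpose = W) (hWunit : W * W.conjTranspose = 1)
    (n : ℕ) (hn : 2 ≤ n) (hne : Even n) :
    (∑ x : Fin n → Fin m,
        Complex.normSq (hafnian (fun i j : Fin n => W (x i) (x j)))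
      = ((n - 1 : ℕ) : ℝ) * ((m + n - 2 : ℕ) : ℝ) *
          ∑ x : Fin (n - 2) → Fin m,
            Complex.normSq (hafnian (fun i j : Fin (n - 2) => W (x i) (x j))))
    ∧ (∑ x : Fin 0 → Fin m,
        Complex.normSq (hafnian (fun i j : Fin 0 => W (x i) (x j))) = 1) := by
  refine ⟨?_, ?_⟩
  · obtain ⟨n, rfl⟩ := Nat.exists_eq_add_of_le' hn
    have h := hafnian_sum_succ_succ W (fun i j => congrFun (congrFun hWsym j) i) hWunit n
    rw [Fintype.card_fin] at h
    rw [show n + 2 - 1 = n + 1 by omega, show m + (n + 2) - 2 = m + n by omega]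
    push_cast
    exact h
  · simp [hafnian]
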